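/- Let k be a field and l a positive integer. Let g be a matrix in the symplectic group Sp(2l, k) (matrices indexed by Fin l ⊕ Fin l satisfying g * J * gᵀ = J, where J is the standard symplectic form matrix) which is monomial with permutation σ ∈ Equiv.Perm (Fin l ⊕ Fin l), and suppose σ is a (2l)-cycle (a cycle whose support is everything). Then g^{2l} = −1, minus the identity matrix. -/

import Mathlib

/-- A square matrix `g` is monomial with permutation `σ` if `g i j ≠ 0` exactly when
`i = σ j`. -/
def Matrix.IsMonomialWith {k : Type*} [Field k] {ι : Type*}
    (g : Matrix ι ι k) (σ : Equiv.Perm ι) : Prop :=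
  ∀ i j, g i j ≠ 0 ↔ i = σ j

namespace Matrix.IsMonomialWith

variable {k : Type*} [Field k] {ι : Type*} [Fintype ι] [DecidableEq ι]
  {g : Matrix ι ι k} {σ : Equiv.Perm ι}

/-- Powers of a monomial matrix are given by products of its entries along orbits. -/
theorem pow_apply (hg : g.IsMonomialWith σ) (n : ℕ) (i j : ι) :
    (g ^ n) i j =
      if i = (σ ^ n) j then ∏ m ∈ Finset.range n, g (σ ((σ ^ m) j)) ((σ ^ m) j) else 0 := by
  induction n generalizing i with
  | zero => simp [Matrix.one_apply]
  | succ n ih =>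
    rw [pow_succ', Matrix.mul_apply, Finset.sum_eq_single ((σ ^ n) j), ih, if_pos rfl,
      pow_succ', Equiv.Perm.mul_apply, Finset.prod_range_succ]
    · split_ifs with h
      · rw [h, mul_comm]
      · rw [not_not.mp (mt (hg _ _).mp h), zero_mul]
    · intro b _ hb
      rw [ih, if_neg hb, mul_zero]
    · simp

/-- The determinant of a monomial matrix is a single term of the Leibniz formula. -/
theorem det_eq (hg : g.IsMonomialWith σ) :
    g.det = Equiv.Perm.sign σ * ∏ i, g (σ i) i := by
  rw [Matrix.det_apply', Finset.sum_eq_single σ]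
  · intro τ _ hτ
    obtain ⟨i, hi⟩ := not_forall.mp (mt Equiv.ext hτ)
    have hzero : g (τ i) i = 0 := not_not.mp (mt (hg _ _).mp hi)
    exact mul_eq_zero_of_right _ (Finset.prod_eq_zero (Finset.mem_univ i) hzero)
  · simp

end Matrix.IsMonomialWith

/-- A product along an orbit of a permutation that cycles `s` is the product over `s`. -/
theorem Equiv.Perm.IsCycleOn.prod_range_pow_apply {ι M : Type*} [CommMonoid M]
    {s : Finset ι} {σ : Equiv.Perm ι} (hσ : σ.IsCycleOn s) (f : ι → M) {j : ι} (hj : j ∈ s) :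
    ∏ m ∈ Finset.range s.card, f ((σ ^ m) j) = ∏ i ∈ s, f i := by
  refine Finset.prod_bij (fun m _ => (σ ^ m) j) ?_ ?_ ?_ (fun _ _ => rfl)
  · intro m _
    exact (hσ.1.perm_pow m).mapsTo hj
  · intro a ha b hb h
    exact ((hσ.pow_apply_eq_pow_apply hj).mp h).eq_of_lt_of_lt
      (Finset.mem_range.mp ha) (Finset.mem_range.mp hb)
  · intro b hb
    obtain ⟨n, hn, h⟩ := hσ.exists_pow_eq hj hb
    exact ⟨n, Finset.mem_range.mpr hn, h⟩

/-- A monomial matrix in the symplectic group `Sp(2l, k)` whose underlying permutation is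
a `(2l)`-cycle (a representative of a Coxeter element of the Weyl group of type `C_l`)
satisfies `g^(2l) = -1`. -/
theorem symplectic_monomial_coxeter_pow
    (k : Type*) [Field k] (l : ℕ) (hl : 0 < l)
    (σ : Equiv.Perm (Fin l ⊕ Fin l)) (hσc : σ.IsCycle) (hσs : σ.support = Finset.univ)
    (g : Matrix (Fin l ⊕ Fin l) (Fin l ⊕ Fin l) k)
    (hgSp : g ∈ Matrix.symplecticGroup (Fin l) k)
    (hg : g.IsMonomialWith σ) :
    g ^ (2 * l) = (-1 : Matrix (Fin l ⊕ Fin l) (Fin l ⊕ Fin l) k) := by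
  have hcard : (Finset.univ : Finset (Fin l ⊕ Fin l)).card = 2 * l := by
    simp [two_mul]
  have hσ : σ.IsCycleOn (Finset.univ : Finset (Fin l ⊕ Fin l)) := by
    rw [← hσs, Equiv.Perm.coe_support_eq_set_support]
    exact hσc.isCycleOn
  have hprod : ∏ i, g (σ i) i = -1 := by
    have hdet := SymplecticGroup.det_eq_one hgSp
    rw [hg.det_eq, hσc.sign, hσs, hcard, (even_two_mul l).neg_one_pow] at hdet
    simpa [neg_eq_iff_eq_neg] using hdet
  have hpow : σ ^ (2 * l) = 1 := by
    rw [← hcard, ← hσs, ← hσc.orderOf, pow_orderOf_eq_one]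
  ext i j
  have horbit := hσ.prod_range_pow_apply (fun i => g (σ i) i) (Finset.mem_univ j)
  rw [hcard, hprod] at horbit
  rw [hg.pow_apply, hpow, horbit]
  by_cases h : i = j <;> simp [h]
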